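/- Let θ ≥ 2 be a real number that is not an integer. There exists a constant C_θ > 0, depending only on θ, such that for every b > 1, every ξ ∈ ℝ, every t ∈ ℝ with t ≠ 0, and every integer p, one has |∫_0^b e^{2πi(xξ + t x^θ − p x)} dx| ≤ C_θ |t|^{−1/θ}. -/

import Mathlib

open MeasureTheory Real

/-- `eC r = e^{2πir}`, the complex exponential. -/
noncomputable def eC (r : ℝ) : ℂ := Complex.exp (2 * Real.pi * Complex.I * r)

/-- Van der Corput's first derivative test for a convex phase. -/
theorem norm_integral_cexp_le_of_le_deriv {φ φ' φ'' : ℝ → ℝ} {a b m : ℝ} (hab : a ≤ b)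
    (hm : 0 < m) (h1 : ∀ x ∈ Set.Icc a b, HasDerivAt φ (φ' x) x)
    (h2 : ∀ x ∈ Set.Icc a b, HasDerivAt φ' (φ'' x) x) (hc : ContinuousOn φ'' (Set.Icc a b))
    (hpos : ∀ x ∈ Set.Icc a b, 0 ≤ φ'' x) (hle : ∀ x ∈ Set.Icc a b, m ≤ φ' x) :
    ‖∫ x in a..b, Complex.exp (φ x * Complex.I)‖ ≤ 3 / m := by
  have hu : Set.uIcc a b = Set.Icc a b := Set.uIcc_of_le hab
  have ha : a ∈ Set.Icc a b := ⟨le_rfl, hab⟩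
  have hb : b ∈ Set.Icc a b := ⟨hab, le_rfl⟩
  have hp : ∀ x ∈ Set.Icc a b, 0 < φ' x := fun x hx => hm.trans_le (hle x hx)
  have c0 : ContinuousOn φ (Set.Icc a b) := fun x hx => (h1 x hx).continuousAt.continuousWithinAt
  have c1 : ContinuousOn φ' (Set.Icc a b) := fun x hx => (h2 x hx).continuousAt.continuousWithinAt
  have cE : ContinuousOn (fun x => Complex.exp (φ x * Complex.I)) (Set.Icc a b) := by fun_prop
  have cq : ContinuousOn (fun x => φ'' x / φ' x ^ 2) (Set.Icc a b) :=
    hc.div (c1.pow 2) fun x hx => (pow_pos (hp x hx) 2).ne'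
  set G : ℝ → ℂ := fun x => Complex.exp (φ x * Complex.I) * ((φ'' x / φ' x ^ 2 : ℝ) : ℂ) * Complex.I
    with hG
  have cG : ContinuousOn G (Set.Icc a b) :=
    (cE.mul (Complex.continuous_ofReal.comp_continuousOn cq)).mul continuousOn_const
  set F : ℝ → ℂ := fun x => -(Complex.exp (φ x * Complex.I) * (((φ' x)⁻¹ : ℝ) : ℂ) * Complex.I)
    with hF
  have hFd : ∀ x ∈ Set.Icc a b,
      HasDerivAt F (Complex.exp (φ x * Complex.I) + G x) x := by
    intro x hx
    have e1 := (((h1 x hx).ofReal_comp).mul_const Complex.I).cexp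
    have e2 := ((h2 x hx).inv (hp x hx).ne').ofReal_comp
    have e3 := ((e1.mul e2).mul_const Complex.I).neg
    refine e3.congr_deriv ?_
    have hne : (φ' x : ℂ) ≠ 0 := by exact_mod_cast (hp x hx).ne'
    simp only [hG, Pi.inv_apply]
    push_cast
    field_simp
    ring_nf
    simp only [Complex.I_sq]
    ring
  have iE : IntervalIntegrable (fun x => Complex.exp (φ x * Complex.I)) volume a b :=
    ContinuousOn.intervalIntegrable (by rwa [hu])
  have iG : IntervalIntegrable G volume a b := ContinuousOn.intervalIntegrable (by rwa [hu])
  have iq : IntervalIntegrable (fun x => φ'' x / φ' x ^ 2) volume a b :=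
    ContinuousOn.intervalIntegrable (by rwa [hu])
  have key := intervalIntegral.integral_eq_sub_of_hasDerivAt (a := a) (b := b)
    (by rwa [hu]) (iE.add iG)
  rw [intervalIntegral.integral_add iE iG] at key
  have keyq : ∫ x in a..b, φ'' x / φ' x ^ 2 = -(φ' b)⁻¹ - -(φ' a)⁻¹ := by
    refine intervalIntegral.integral_eq_sub_of_hasDerivAt (f := fun x => -(φ' x)⁻¹) ?_ iq
    rw [hu]
    intro x hx
    refine ((h2 x hx).inv (hp x hx).ne').neg.congr_deriv ?_
    ring
  have nF : ∀ x ∈ Set.Icc a b, ‖F x‖ = (φ' x)⁻¹ := by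
    intro x hx
    simp [hF, Complex.norm_exp_ofReal_mul_I, abs_of_pos (hp x hx)]
  have nG : ‖∫ x in a..b, G x‖ ≤ ∫ x in a..b, φ'' x / φ' x ^ 2 := by
    refine intervalIntegral.norm_integral_le_of_norm_le hab ?_ iq
    refine Filter.Eventually.of_forall fun x hx => ?_
    have hx' : x ∈ Set.Icc a b := ⟨hx.1.le, hx.2⟩
    simp [hG, Complex.norm_exp_ofReal_mul_I, abs_of_nonneg (hpos x hx')]
  have bound : ∀ x ∈ Set.Icc a b, (φ' x)⁻¹ ≤ m⁻¹ := fun x hx => inv_anti₀ hm (hle x hx)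
  have hbi : 0 < (φ' b)⁻¹ := inv_pos.2 (hp b hb)
  rw [eq_sub_of_add_eq key]
  calc _ ≤ ‖F b‖ + ‖F a‖ + ‖∫ x in a..b, G x‖ :=
        (norm_sub_le _ _).trans (by gcongr; exact norm_sub_le _ _)
    _ ≤ m⁻¹ + m⁻¹ + m⁻¹ := by
        rw [nF a ha, nF b hb]
        rw [keyq] at nG
        linarith [bound a ha, bound b hb]
    _ = 3 / m := by ring

theorem norm_integral_cexp_mul_I_le (φ : ℝ → ℝ) {a b : ℝ} (hab : a ≤ b) :
    ‖∫ x in a..b, Complex.exp (φ x * Complex.I)‖ ≤ b - a := by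
  have := intervalIntegral.norm_integral_le_of_norm_le_const (a := a) (b := b) (C := 1)
    (f := fun x => Complex.exp (φ x * Complex.I))
    fun x _ => (Complex.norm_exp_ofReal_mul_I _).le
  rwa [one_mul, abs_of_nonneg (sub_nonneg.2 hab)] at this

/-- The second derivative test on an interval where the phase is increasing. -/
theorem norm_integral_cexp_le_of_le_deriv2_of_deriv_nonneg {φ φ' φ'' : ℝ → ℝ} {a b δ : ℝ}
    (hab : a ≤ b) (hδ : 0 < δ) (h1 : ∀ x ∈ Set.Icc a b, HasDerivAt φ (φ' x) x)
    (h2 : ∀ x ∈ Set.Icc a b, HasDerivAt φ' (φ'' x) x) (hc : ContinuousOn φ'' (Set.Icc a b))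
    (hle : ∀ x ∈ Set.Icc a b, (δ ^ 2)⁻¹ ≤ φ'' x) (ha : 0 ≤ φ' a) :
    ‖∫ x in a..b, Complex.exp (φ x * Complex.I)‖ ≤ 4 * δ := by
  rcases le_total b (a + δ) with hb | hb
  · linarith [norm_integral_cexp_mul_I_le φ hab]
  have hsub : Set.Icc (a + δ) b ⊆ Set.Icc a b := Set.Icc_subset_Icc_left (by linarith)
  have c0 : ContinuousOn φ (Set.Icc a b) := fun x hx => (h1 x hx).continuousAt.continuousWithinAt
  have c1 : ContinuousOn φ' (Set.Icc a b) := fun x hx => (h2 x hx).continuousAt.continuousWithinAt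
  have cE : ContinuousOn (fun x => Complex.exp (φ x * Complex.I)) (Set.Icc a b) := by fun_prop
  have hgrow : ∀ x ∈ Set.Icc (a + δ) b, δ⁻¹ ≤ φ' x := by
    intro x hx
    have hmv := (convex_Icc a b).mul_sub_le_image_sub_of_le_deriv c1
      (fun y hy => (h2 y (interior_subset hy)).differentiableAt.differentiableWithinAt)
      (C := (δ ^ 2)⁻¹)
      (fun y hy => by rw [(h2 y (interior_subset hy)).deriv]; exact hle y (interior_subset hy))
      a ⟨le_rfl, hab⟩ x (hsub hx) (hsub hx).1
    have : (δ ^ 2)⁻¹ * δ ≤ (δ ^ 2)⁻¹ * (x - a) := by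
      gcongr
      linarith [hx.1]
    have e : (δ ^ 2)⁻¹ * δ = δ⁻¹ := by field_simp
    linarith
  have hfar := norm_integral_cexp_le_of_le_deriv hb (inv_pos.2 hδ) (fun x hx => h1 x (hsub hx))
    (fun x hx => h2 x (hsub hx)) (hc.mono hsub)
    (fun x hx => (by positivity : (0 : ℝ) ≤ (δ ^ 2)⁻¹).trans (hle x (hsub hx))) hgrow
  have hnear := norm_integral_cexp_mul_I_le φ (show a ≤ a + δ by linarith)
  rw [← intervalIntegral.integral_add_adjacent_intervals (b := a + δ)
    (ContinuousOn.intervalIntegrable_of_Icc (by linarith)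
      (cE.mono (Set.Icc_subset_Icc_right hb)))
    (ContinuousOn.intervalIntegrable_of_Icc hb (cE.mono hsub))]
  rw [div_inv_eq_mul] at hfar
  linarith [norm_add_le (∫ x in a..(a + δ), Complex.exp (φ x * Complex.I))
    (∫ x in (a + δ)..b, Complex.exp (φ x * Complex.I))]

/-- The second derivative test on an interval where the phase is decreasing. -/
theorem norm_integral_cexp_le_of_le_deriv2_of_deriv_nonpos {φ φ' φ'' : ℝ → ℝ} {a b δ : ℝ}
    (hab : a ≤ b) (hδ : 0 < δ) (h1 : ∀ x ∈ Set.Icc a b, HasDerivAt φ (φ' x) x)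
    (h2 : ∀ x ∈ Set.Icc a b, HasDerivAt φ' (φ'' x) x) (hc : ContinuousOn φ'' (Set.Icc a b))
    (hle : ∀ x ∈ Set.Icc a b, (δ ^ 2)⁻¹ ≤ φ'' x) (hb : φ' b ≤ 0) :
    ‖∫ x in a..b, Complex.exp (φ x * Complex.I)‖ ≤ 4 * δ := by
  have hmem : ∀ x ∈ Set.Icc (-b) (-a), -x ∈ Set.Icc a b := fun x hx =>
    ⟨by linarith [hx.2], by linarith [hx.1]⟩
  have h := norm_integral_cexp_le_of_le_deriv2_of_deriv_nonneg (φ := fun x => φ (-x))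
    (φ' := fun x => -φ' (-x)) (φ'' := fun x => φ'' (-x)) (neg_le_neg hab) hδ
    (fun x hx => ((h1 (-x) (hmem x hx)).comp x (hasDerivAt_neg x)).congr_deriv (by ring))
    (fun x hx => ((h2 (-x) (hmem x hx)).comp x (hasDerivAt_neg x)).neg.congr_deriv (by ring))
    (hc.comp continuous_neg.continuousOn hmem) (fun x hx => hle (-x) (hmem x hx))
    (by simpa using hb)
  rw [intervalIntegral.integral_comp_neg (fun x => Complex.exp (φ x * Complex.I))] at h
  simpa using h

/-- Van der Corput's second derivative test. -/
theorem norm_integral_cexp_le_of_le_deriv2 {φ φ' φ'' : ℝ → ℝ} {a b δ : ℝ}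
    (hab : a ≤ b) (hδ : 0 < δ) (h1 : ∀ x ∈ Set.Icc a b, HasDerivAt φ (φ' x) x)
    (h2 : ∀ x ∈ Set.Icc a b, HasDerivAt φ' (φ'' x) x) (hc : ContinuousOn φ'' (Set.Icc a b))
    (hle : ∀ x ∈ Set.Icc a b, (δ ^ 2)⁻¹ ≤ φ'' x) :
    ‖∫ x in a..b, Complex.exp (φ x * Complex.I)‖ ≤ 8 * δ := by
  rcases le_total 0 (φ' a) with ha | ha
  · linarith [norm_integral_cexp_le_of_le_deriv2_of_deriv_nonneg hab hδ h1 h2 hc hle ha]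
  rcases le_total (φ' b) 0 with hb | hb
  · linarith [norm_integral_cexp_le_of_le_deriv2_of_deriv_nonpos hab hδ h1 h2 hc hle hb]
  have c0 : ContinuousOn φ (Set.Icc a b) := fun x hx => (h1 x hx).continuousAt.continuousWithinAt
  have c1 : ContinuousOn φ' (Set.Icc a b) := fun x hx => (h2 x hx).continuousAt.continuousWithinAt
  have cE : ContinuousOn (fun x => Complex.exp (φ x * Complex.I)) (Set.Icc a b) := by fun_prop
  obtain ⟨c, hcm, hc0⟩ := intermediate_value_Icc hab c1 ⟨ha, hb⟩
  have sl : Set.Icc a c ⊆ Set.Icc a b := Set.Icc_subset_Icc_right hcm.2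
  have sr : Set.Icc c b ⊆ Set.Icc a b := Set.Icc_subset_Icc_left hcm.1
  have hl := norm_integral_cexp_le_of_le_deriv2_of_deriv_nonpos hcm.1 hδ
    (fun x hx => h1 x (sl hx)) (fun x hx => h2 x (sl hx)) (hc.mono sl)
    (fun x hx => hle x (sl hx)) hc0.le
  have hr := norm_integral_cexp_le_of_le_deriv2_of_deriv_nonneg hcm.2 hδ
    (fun x hx => h1 x (sr hx)) (fun x hx => h2 x (sr hx)) (hc.mono sr)
    (fun x hx => hle x (sr hx)) hc0.ge
  rw [← intervalIntegral.integral_add_adjacent_intervals (b := c)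
    (ContinuousOn.intervalIntegrable_of_Icc hcm.1 (cE.mono sl))
    (ContinuousOn.intervalIntegrable_of_Icc hcm.2 (cE.mono sr))]
  linarith [norm_add_le (∫ x in a..c, Complex.exp (φ x * Complex.I))
    (∫ x in c..b, Complex.exp (φ x * Complex.I))]

theorem norm_integral_cexp_linear_add_rpow_le {θ s b : ℝ} (hθ : 2 ≤ θ) (hs : 0 < s)
    (hb : 0 ≤ b) (α : ℝ) :
    ‖∫ x in (0 : ℝ)..b, Complex.exp (((α * x + s * x ^ θ : ℝ) : ℂ) * Complex.I)‖
      ≤ 9 * s ^ (-(1 / θ)) := by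
  set δ := s ^ (-(1 / θ)) with hδdef
  have hδ : 0 < δ := rpow_pos_of_pos hs _
  set φ : ℝ → ℝ := fun x => α * x + s * x ^ θ with hφ
  change ‖∫ x in (0 : ℝ)..b, Complex.exp ((φ x : ℂ) * Complex.I)‖ ≤ 9 * δ
  rcases le_total b δ with hbδ | hbδ
  · linarith [norm_integral_cexp_mul_I_le φ hb]
  have hcφ : Continuous φ :=
    (continuous_const.mul continuous_id).add
      (continuous_const.mul (continuous_id.rpow_const fun _ => Or.inr (by linarith)))
  have cE : Continuous (fun x => Complex.exp (φ x * Complex.I)) := by fun_prop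
  have hfar : ‖∫ x in δ..b, Complex.exp ((φ x : ℂ) * Complex.I)‖ ≤ 8 * δ := by
    refine norm_integral_cexp_le_of_le_deriv2
      (φ' := fun x => α + s * (θ * x ^ (θ - 1)))
      (φ'' := fun x => s * (θ * ((θ - 1) * x ^ (θ - 2)))) hbδ hδ ?_ ?_ ?_ ?_
    · intro x hx
      have hx0 : x ≠ 0 := (hδ.trans_le hx.1).ne'
      exact (((hasDerivAt_id x).const_mul α).add
        ((hasDerivAt_rpow_const (Or.inl hx0)).const_mul s)).congr_deriv (by ring)
    · intro x hx
      have hx0 : x ≠ 0 := (hδ.trans_le hx.1).ne'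
      refine ((((hasDerivAt_rpow_const (p := θ - 1) (Or.inl hx0)).const_mul θ).const_mul
        s).const_add α).congr_deriv ?_
      rw [show θ - 1 - 1 = θ - 2 by ring]
    · exact (continuous_const.mul (continuous_const.mul (continuous_const.mul
        (continuous_id.rpow_const fun _ => Or.inr (by linarith))))).continuousOn
    · intro x hx
      have e : s * δ ^ (θ - 2) = (δ ^ 2)⁻¹ := by
        have hθ0 : θ ≠ 0 := by linarith
        have e1 : δ ^ θ = s⁻¹ := by
          rw [hδdef, ← rpow_mul hs.le, show -(1 / θ) * θ = -1 by field_simp, rpow_neg_one]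
        rw [rpow_sub hδ, e1, rpow_two]
        field_simp
      have h3 : δ ^ (θ - 2) ≤ x ^ (θ - 2) := rpow_le_rpow hδ.le hx.1 (by linarith)
      have h0 : 0 ≤ x ^ (θ - 2) := rpow_nonneg (hδ.le.trans hx.1) _
      have h4 : x ^ (θ - 2) ≤ θ * ((θ - 1) * x ^ (θ - 2)) := by
        have : 1 ≤ θ * (θ - 1) := by nlinarith
        nlinarith
      rw [← e]
      exact mul_le_mul_of_nonneg_left (h3.trans h4) hs.le
  have hnear := norm_integral_cexp_mul_I_le φ hδ.le
  rw [← intervalIntegral.integral_add_adjacent_intervals (b := δ)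
    (cE.intervalIntegrable _ _) (cE.intervalIntegrable _ _)]
  linarith [norm_add_le (∫ x in (0 : ℝ)..δ, Complex.exp (φ x * Complex.I))
    (∫ x in δ..b, Complex.exp (φ x * Complex.I))]

theorem norm_eC_integral_neg (f : ℝ → ℝ) (a b : ℝ) :
    ‖∫ x in a..b, eC (-f x)‖ = ‖∫ x in a..b, eC (f x)‖ := by
  have h : ∀ x, eC (-f x) = (starRingEnd ℂ) (eC (f x)) := by
    intro x
    simp [eC, ← Complex.exp_conj, Complex.conj_ofNat]
  simp_rw [h]
  rw [intervalIntegral, integral_conj, integral_conj, ← map_sub, RCLike.norm_conj, intervalIntegral]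

theorem norm_integral_eC_le {θ t b : ℝ} (hθ : 2 ≤ θ) (ht : 0 < t) (hb : 0 ≤ b) (β : ℝ) :
    ‖∫ x in (0 : ℝ)..b, eC (β * x + t * x ^ θ)‖ ≤ 9 * t ^ (-(1 / θ)) := by
  have h := norm_integral_cexp_linear_add_rpow_le hθ (mul_pos two_pi_pos ht) hb (2 * π * β)
  have e : ∀ x : ℝ, eC (β * x + t * x ^ θ) =
      Complex.exp (((2 * π * β * x + 2 * π * t * x ^ θ : ℝ) : ℂ) * Complex.I) := by
    intro x
    unfold eC
    congr 1
    push_cast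
    ring
  simp_rw [e]
  refine h.trans (mul_le_mul_of_nonneg_left ?_ (by norm_num))
  refine rpow_le_rpow_of_nonpos ht ?_ ?_
  · nlinarith [pi_gt_three]
  · have : 0 < θ := by linarith
    simp only [one_div, Left.neg_nonpos_iff]
    positivity

/-- Let `θ ≥ 2` be a non-integer real. There is `C_θ > 0` (independent of `b, ξ, t, p`)
such that for every `b > 1`, `ξ ∈ ℝ`, `t ≠ 0` and every integer `p`,
`|∫_0^b e^{2πi(xξ + t x^θ - p x)} dx| ≤ C_θ |t|^{-1/θ}`. -/
theorem oscillatory_integral_fractional_phase (θ : ℝ) (hθ : 2 ≤ θ)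
    (hnonint : ∀ z : ℤ, θ ≠ (z : ℝ)) :
    ∃ C : ℝ, 0 < C ∧
      ∀ (b ξ t : ℝ) (p : ℤ), 1 < b → t ≠ 0 →
        ‖∫ x in (0:ℝ)..b, eC (x * ξ + t * x ^ θ - p * x)‖ ≤ C * |t| ^ (-(1 / θ)) := by
  refine ⟨9, by norm_num, fun b ξ t p hb ht => ?_⟩
  have hb0 : 0 ≤ b := by linarith
  rcases lt_or_gt_of_ne ht with ht | ht
  · rw [abs_of_neg ht, ← norm_eC_integral_neg]
    convert norm_integral_eC_le hθ (neg_pos.2 ht) hb0 (p - ξ) using 6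
    ring
  · rw [abs_of_pos ht]
    convert norm_integral_eC_le hθ ht hb0 (ξ - p) using 6
    ring
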